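/- Let x_i < x_j be real numbers and let 0 < σ_i < σ_j. Then the exact equally-likely optimal threshold r* = (σ_j²·x_i − σ_i²·x_j + σ_i·σ_j·√((x_j − x_i)² + 2(σ_j² − σ_i²)·log(σ_j/σ_i)))/(σ_j² − σ_i²) is at least the approximate threshold r̂ = (x_i·σ_j + x_j·σ_i)/(σ_i + σ_j); i.e., r* ≥ r̂, and in particular r* > x_i. -/

import Mathlib

theorem exact_threshold_ge_approx_threshold
    (xi xj σi σj : ℝ)
    (hx : xi < xj) (hσi : 0 < σi) (hσ : σi < σj)
    (rstar rhat : ℝ)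
    (hrstar : rstar = (σj ^ 2 * xi - σi ^ 2 * xj
            + σi * σj * Real.sqrt ((xj - xi) ^ 2 + 2 * (σj ^ 2 - σi ^ 2) * Real.log (σj / σi)))
          / (σj ^ 2 - σi ^ 2))
    (hrhat : rhat = (xi * σj + xj * σi) / (σi + σj)) :
    rhat ≤ rstar ∧ xi < rstar := by
  have hσj : 0 < σj := hσi.trans hσ
  have hden : 0 < σj ^ 2 - σi ^ 2 := by nlinarith
  have hlog : 0 ≤ Real.log (σj / σi) := Real.log_nonneg ((one_le_div hσi).2 hσ.le)
  have hsqrt : xj - xi ≤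
      Real.sqrt ((xj - xi) ^ 2 + 2 * (σj ^ 2 - σi ^ 2) * Real.log (σj / σi)) :=
    Real.le_sqrt_of_sq_le (le_add_of_nonneg_right (by positivity))
  have hle : rhat ≤ rstar := by
    have hfactor : rhat * (σj ^ 2 - σi ^ 2) =
        σj ^ 2 * xi - σi ^ 2 * xj + σi * σj * (xj - xi) := by
      rw [hrhat]
      field_simp
      ring
    rw [hrstar, le_div_iff₀ hden, hfactor]
    gcongr
  have hlt : xi < rhat := by
    rw [hrhat, lt_div_iff₀ (by positivity)]
    nlinarith
  exact ⟨hle, hlt.trans_le hle⟩
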